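/- Let k be a field of characteristic 0, let i ≥ 0, and let R = k[t]/(t^{i+1}) with x the image of t. For each a ∈ k let σ_a : R → R be the k-algebra endomorphism determined by σ_a(x) = x·(1 + a·x)^{-1} (the element 1 + a·x is a unit of R since x is nilpotent). Then every k-subalgebra B of R satisfying σ_a(B) ⊆ B for all a ∈ k is of the form k·1 ⊕ (x^{δ+1}) for some δ ∈ {0, 1, …, i}; explicitly, there exists d with 1 ≤ d ≤ i+1 such that B equals the k-linear span of {1} ∪ {x^j : d ≤ j ≤ i}. -/

import Mathlib

/-- The truncated polynomial algebra `k[t]/(t^(i+1))`. -/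
abbrev TruncPoly (k : Type*) [Field k] (i : ℕ) : Type _ :=
  Polynomial k ⧸ Ideal.span {(Polynomial.X : Polynomial k) ^ (i + 1)}

/-- A subspace of an algebra with nilpotent generator `x` that has elements of every order `j ≥ d`
contains the ideal `(x ^ d)`. -/
theorem pow_mul_mem_of_forall_order {k R : Type*} [Field k] [CommRing R] [Algebra k R] {x : R}
    {n : ℕ} (hn : x ^ n = 0) (hR : ∀ r : R, ∃ (e : k) (s : R), r = algebraMap k R e + x * s)
    (M : Submodule k R) {d : ℕ} (hd : d ≤ n)
    (hM : ∀ j, d ≤ j → ∃ (c : k) (r : R), c ≠ 0 ∧ c • x ^ j + x ^ (j + 1) * r ∈ M) (r : R) :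
    x ^ d * r ∈ M := by
  induction hd using Nat.decreasingInduction generalizing r with
  | self => simp [hn]
  | of_succ j hj ih =>
    have ih' := ih fun m hm => hM m (by omega)
    obtain ⟨c, s, hc, hs⟩ := hM j le_rfl
    have hx : x ^ j ∈ M := by
      have h := M.smul_mem c⁻¹ (M.sub_mem hs (ih' s))
      rwa [add_sub_cancel_right, smul_smul, inv_mul_cancel₀ hc, one_smul] at h
    obtain ⟨e, t, rfl⟩ := hR r
    have h := M.add_mem (M.smul_mem e hx) (ih' t)
    rw [Algebra.smul_def] at h
    convert h using 1
    ring

/-- If `u = 1 - x + O(x²)` then `u ^ j = 1 - j x + O(x²)`. -/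
theorem exists_pow_eq_one_sub_nsmul_add {R : Type*} [CommRing R] {x u v : R}
    (hu : u = 1 - x + x ^ 2 * v) (j : ℕ) :
    ∃ w : R, u ^ j = 1 - j * x + x ^ 2 * w := by
  induction j with
  | zero => exact ⟨0, by simp⟩
  | succ j ih =>
    obtain ⟨w, hw⟩ := ih
    refine ⟨v + w * u + j * (1 - x * v), ?_⟩
    rw [pow_succ, hw, hu]
    push_cast
    ring

/-- If `σ x = x (1 - x + O(x²))`, then `σ - 1` sends `c x ^ j + O(x ^ (j + 1))` to
`-j c x ^ (j + 1) + O(x ^ (j + 2))`. -/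
theorem exists_map_sub_self_eq {k R : Type*} [Field k] [CommRing R] [Algebra k R] {x u v : R}
    (hR : ∀ r : R, ∃ (e : k) (s : R), r = algebraMap k R e + x * s)
    (hu : u = 1 - x + x ^ 2 * v) (σ : R →ₐ[k] R) (hσ : σ x = x * u) (c : k) (j : ℕ) (r : R) :
    ∃ t : R, σ (c • x ^ j + x ^ (j + 1) * r) - (c • x ^ j + x ^ (j + 1) * r) =
      (-(j * c) : k) • x ^ (j + 1) + x ^ (j + 1 + 1) * t := by
  obtain ⟨w, hw⟩ := exists_pow_eq_one_sub_nsmul_add hu j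
  obtain ⟨w', hw'⟩ := exists_pow_eq_one_sub_nsmul_add hu (j + 1)
  obtain ⟨e, s, rfl⟩ := hR r
  refine ⟨algebraMap k R c * w + (-((j + 1 : ℕ) : R) + x * w') * (algebraMap k R e + x * u * σ s)
    + (u * σ s - s), ?_⟩
  simp only [Algebra.smul_def, map_add, map_mul, map_pow, map_neg, map_natCast, hσ, mul_pow,
    AlgHom.commutes]
  rw [hw, hw']
  ring

/-- The classification of subalgebras stable under `σ x = x (1 - x + O(x²))`, for an algebra
generated by a nilpotent element `x`. -/
theorem exists_toSubmodule_eq_span_of_map_mem {k R : Type*} [Field k] [CharZero k] [CommRing R]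
    [Algebra k R] {x u v : R} {i : ℕ} (hn : x ^ (i + 1) = 0)
    (hR : ∀ r : R, ∃ (e : k) (s : R), r = algebraMap k R e + x * s)
    (hu : u = 1 - x + x ^ 2 * v) (σ : R →ₐ[k] R) (hσ : σ x = x * u) (B : Subalgebra k R)
    (hB : ∀ b ∈ B, σ b ∈ B) :
    ∃ d : ℕ, 1 ≤ d ∧ d ≤ i + 1 ∧ Subalgebra.toSubmodule B =
      Submodule.span k ({1} ∪ {y : R | ∃ j : ℕ, d ≤ j ∧ j ≤ i ∧ y = x ^ j}) := by
  classical
  let P : ℕ → Prop := fun j =>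
    1 ≤ j ∧ ∃ (c : k) (r : R), c ≠ 0 ∧ c • x ^ j + x ^ (j + 1) * r ∈ B
  have hP : P (i + 1) := ⟨by omega, 1, 0, one_ne_zero, by simp [hn]⟩
  have hex : ∃ j, P j := ⟨_, hP⟩
  obtain ⟨d, hd, hmin⟩ : ∃ d, P d ∧ ∀ m < d, ¬ P m :=
    ⟨Nat.find hex, Nat.find_spec hex, fun _ => Nat.find_min hex⟩
  have hdi : d ≤ i + 1 := not_lt.1 fun h => hmin _ h hP
  have hPall : ∀ j, d ≤ j → P j := by
    intro j hj
    induction j, hj using Nat.le_induction with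
    | base => exact hd
    | succ j _ ih =>
      obtain ⟨hj, c, r, hc, hmem⟩ := ih
      obtain ⟨t, ht⟩ := exists_map_sub_self_eq hR hu σ hσ c j r
      refine ⟨by omega, -(j * c), t, ?_, ht ▸ B.sub_mem (hB _ hmem) hmem⟩
      exact neg_ne_zero.2 (mul_ne_zero (Nat.cast_ne_zero.2 (by omega)) hc)
  refine ⟨d, hd.1, hdi, le_antisymm ?_ ?_⟩
  · intro b hb
    have hord : ∀ j, 1 ≤ j → j ≤ d → ∃ (e : k) (s : R), b = algebraMap k R e + x ^ j * s := by
      intro j hj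
      induction j, hj using Nat.le_induction with
      | base => exact fun _ => by simpa using hR b
      | succ j hj ih =>
        intro hjd
        obtain ⟨e, s, hs⟩ := ih (by omega)
        obtain ⟨c, t, rfl⟩ := hR s
        have hc : c = 0 := by
          by_contra hc
          refine hmin j (by omega) ⟨hj, c, t, hc, ?_⟩
          have h := B.sub_mem hb (B.algebraMap_mem e)
          rw [hs, add_sub_cancel_left] at h
          convert h using 1
          rw [Algebra.smul_def]
          ring
        refine ⟨e, t, ?_⟩
        rw [hs, hc, map_zero]
        ring
    obtain ⟨e, s, rfl⟩ := hord d hd.1 le_rfl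
    refine Submodule.add_mem _ ?_ (pow_mul_mem_of_forall_order hn hR _ hdi (fun j hj => ?_) s)
    · rw [Algebra.algebraMap_eq_smul_one]
      exact Submodule.smul_mem _ _ (Submodule.subset_span (Or.inl rfl))
    · refine ⟨1, 0, one_ne_zero, ?_⟩
      rw [one_smul, mul_zero, add_zero]
      by_cases hji : j ≤ i
      · exact Submodule.subset_span (Or.inr ⟨j, hj, hji, rfl⟩)
      · rw [pow_eq_zero_of_le (by omega) hn]
        exact Submodule.zero_mem _
  · rw [Submodule.span_le]
    rintro y (rfl | ⟨j, hj, hji, rfl⟩)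
    · exact B.one_mem
    · have h := pow_mul_mem_of_forall_order hn hR (Subalgebra.toSubmodule B) (d := j) (by omega)
        (fun m hm => (hPall m (hj.trans hm)).2) 1
      rwa [mul_one] at h

/-- **Classification of 𝔾ₐ-equivariant subalgebras of `k[t]/(t^(i+1))`.**
Let `k` be a field of characteristic `0`, `R = k[t]/(t^(i+1))` and `x` the image of `t`.
For `a ∈ k`, let `σ_a` be the `k`-algebra endomorphism of `R` with
`σ_a x = x * (1 + a*x)⁻¹`.  If a `k`-subalgebra `B ⊆ R` satisfies `σ_a(B) ⊆ B` for every
`a ∈ k`, then there is `d` with `1 ≤ d ≤ i + 1` such that `B` is the `k`-linear span of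
`{1} ∪ {x^j : d ≤ j ≤ i}`, i.e. `B = k·1 ⊕ (x^(δ+1))` for `δ = d - 1 ∈ {0, …, i}`. -/
theorem stmt_0 (k : Type*) [Field k] [CharZero k] (i : ℕ)
    (x : TruncPoly k i)
    (hx : x = Ideal.Quotient.mk (Ideal.span {(Polynomial.X : Polynomial k) ^ (i + 1)})
      Polynomial.X)
    (B : Subalgebra k (TruncPoly k i))
    (hB : ∀ (a : k) (σ : TruncPoly k i →ₐ[k] TruncPoly k i),
      σ x = x * Ring.inverse (1 + algebraMap k (TruncPoly k i) a * x) →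
      ∀ b ∈ B, σ b ∈ B) :
    ∃ d : ℕ, 1 ≤ d ∧ d ≤ i + 1 ∧
      Subalgebra.toSubmodule B =
        Submodule.span k ({1} ∪ {y : TruncPoly k i | ∃ j : ℕ, d ≤ j ∧ j ≤ i ∧ y = x ^ j}) := by
  have hn : x ^ (i + 1) = 0 := by
    rw [hx, ← map_pow]
    exact Ideal.Quotient.eq_zero_iff_mem.2 (Ideal.mem_span_singleton_self _)
  have hR : ∀ r : TruncPoly k i, ∃ (e : k) (s : TruncPoly k i),
      r = algebraMap k (TruncPoly k i) e + x * s := by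
    intro r
    obtain ⟨p, rfl⟩ := Ideal.Quotient.mk_surjective r
    refine ⟨p.coeff 0, Ideal.Quotient.mk _ p.divX, ?_⟩
    conv_lhs => rw [← Polynomial.divX_mul_X_add p]
    rw [map_add, map_mul, hx, add_comm, mul_comm]
    rfl
  have hunit : IsUnit (1 + x) := IsNilpotent.isUnit_one_add ⟨_, hn⟩
  have hinv : (1 + x) * Ring.inverse (1 + x) = 1 := Ring.mul_inverse_cancel _ hunit
  set u := Ring.inverse (1 + x)
  have hu : u = 1 - x + x ^ 2 * u := by linear_combination (1 - x) * hinv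
  let σ : TruncPoly k i →ₐ[k] TruncPoly k i :=
    Ideal.Quotient.liftₐ _ (Polynomial.aeval (x * u)) fun p hp => by
      obtain ⟨q, rfl⟩ := Ideal.mem_span_singleton.1 hp
      simp [mul_pow, hn]
  have hσ : σ x = x * u := by
    conv_lhs => rw [hx]
    exact Polynomial.aeval_X (x * u)
  exact exists_toSubmodule_eq_span_of_map_mem hn hR hu σ hσ B
    (hB 1 σ (by rw [hσ, map_one, one_mul]))
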